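/- Let S and T be left semi-braces whose associated maps r_S and r_T are set-theoretical solutions of the Yang-Baxter equation, and let B be the asymmetric product of S and T via σ, δ and 𝔟. If, in addition, (u^{1_S})^a = u^a, 𝔟(1_S, a) + u = 1_T + u, and 𝔟(a, 1_S + b) = 𝔟(a,b) hold for all a,b ∈ S and u ∈ T, where 1_S and 1_T are the identities of the groups (S,·) and (T,·), then the map r_B associated to B is a set-theoretical solution of the Yang-Baxter equation. -/

import Mathlib

/-- An inverse semigroup: a semigroup in which every element `a` has a unique
element `inv a` satisfying `a * inv a * a = a` and `inv a * a * inv a = inv a`. -/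
structure InvSemigroup (S : Type*) where
  mul : S → S → S
  inv : S → S
  mul_assoc : ∀ a b c : S, mul (mul a b) c = mul a (mul b c)
  mul_inv_mul : ∀ a : S, mul (mul a (inv a)) a = a
  inv_mul_inv : ∀ a : S, mul (mul (inv a) a) (inv a) = inv a
  inv_unique : ∀ a x : S, mul (mul a x) a = a → mul (mul x a) x = x → x = inv a

/-- A left inverse semi-brace: `(S,+)` a semigroup, `(S,·)` an inverse semigroup,
with `a·(b+c) = a·b + a·(a⁻¹+c)`. -/
structure LeftInvSemiBrace (S : Type*) extends InvSemigroup S where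
  add : S → S → S
  add_assoc : ∀ a b c : S, add (add a b) c = add a (add b c)
  brace : ∀ a b c : S, mul a (add b c) = add (mul a b) (mul a (add (inv a) c))

/-- `λ_a(b) = a·(a⁻¹+b)`. -/
def LeftInvSemiBrace.lam {S : Type*} (B : LeftInvSemiBrace S) (a b : S) : S :=
  B.mul a (B.add (B.inv a) b)

/-- `ρ_b(a) = (a⁻¹+b)⁻¹·b`. -/
def LeftInvSemiBrace.rho {S : Type*} (B : LeftInvSemiBrace S) (b a : S) : S :=
  B.mul (B.inv (B.add (B.inv a) b)) b

/-- The map associated to a left inverse semi-brace: `r(a,b) = (λ_a(b), ρ_b(a))`. -/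
def LeftInvSemiBrace.rmap {S : Type*} (B : LeftInvSemiBrace S) : S × S → S × S :=
  fun p => (B.lam p.1 p.2, B.rho p.2 p.1)

/-- `r × id` on `S × S × S`. -/
def rOne {S : Type*} (r : S × S → S × S) : S × S × S → S × S × S :=
  fun p => ((r (p.1, p.2.1)).1, (r (p.1, p.2.1)).2, p.2.2)

/-- `id × r` on `S × S × S`. -/
def rTwo {S : Type*} (r : S × S → S × S) : S × S × S → S × S × S :=
  fun p => (p.1, r p.2)

/-- `r` is a set-theoretical solution of the Yang-Baxter equation. -/
def IsYBE {S : Type*} (r : S × S → S × S) : Prop :=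
  rOne r ∘ rTwo r ∘ rOne r = rTwo r ∘ rOne r ∘ rTwo r

/-- A left semi-brace: `(S,+)` a semigroup, `(S,·)` a group,
with `a·(b+c) = a·b + a·(a⁻¹+c)`. -/
structure LeftSemiBrace (S : Type*) where
  add : S → S → S
  mul : S → S → S
  one : S
  inv : S → S
  add_assoc : ∀ a b c : S, add (add a b) c = add a (add b c)
  mul_assoc : ∀ a b c : S, mul (mul a b) c = mul a (mul b c)
  one_mul : ∀ a : S, mul one a = a
  mul_one : ∀ a : S, mul a one = a
  mul_inv : ∀ a : S, mul a (inv a) = one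
  inv_mul : ∀ a : S, mul (inv a) a = one
  brace : ∀ a b c : S, mul a (add b c) = add (mul a b) (mul a (add (inv a) c))

/-- `λ_a(b) = a·(a⁻¹+b)`. -/
def LeftSemiBrace.lam {S : Type*} (B : LeftSemiBrace S) (a b : S) : S :=
  B.mul a (B.add (B.inv a) b)

/-- `ρ_b(a) = (a⁻¹+b)⁻¹·b`. -/
def LeftSemiBrace.rho {S : Type*} (B : LeftSemiBrace S) (b a : S) : S :=
  B.mul (B.inv (B.add (B.inv a) b)) b

/-- The map associated to a left semi-brace: `r(a,b) = (λ_a(b), ρ_b(a))`. -/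
def LeftSemiBrace.rmap {S : Type*} (B : LeftSemiBrace S) : S × S → S × S :=
  fun p => (B.lam p.1 p.2, B.rho p.2 p.1)

/-- A left semi-brace, presented through the type classes of its two operations. -/
class SemiBrace (T : Type*) extends Group T, AddSemigroup T where
  brace (a b c : T) : a * (b + c) = a * b + a * (a⁻¹ + c)

/-- The type class structure underlying a left semi-brace. -/
abbrev LeftSemiBrace.toSemiBrace {S : Type*} (B : LeftSemiBrace S) : SemiBrace S where
  mul := B.mul
  add := B.add
  one := B.one
  inv := B.inv
  mul_assoc := B.mul_assoc
  one_mul := B.one_mul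
  mul_one := B.mul_one
  inv_mul_cancel := B.inv_mul
  add_assoc := B.add_assoc
  brace := B.brace

namespace SemiBrace

variable {T : Type*} [SemiBrace T]

/-- `λ_a(b) = a * (a⁻¹ + b)`. -/
def lam (a b : T) : T := a * (a⁻¹ + b)

/-- `ρ_b(a) = (a⁻¹ + b)⁻¹ * b`. -/
def rho (b a : T) : T := (a⁻¹ + b)⁻¹ * b

theorem mul_add_eq (a b c : T) : a * (b + c) = a * b + lam a c := brace a b c

theorem lam_add (a b c : T) : lam a (b + c) = lam a b + lam a c := by
  rw [lam, ← add_assoc, mul_add_eq, ← lam]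

theorem lam_mul (a b c : T) : lam (a * b) c = lam a (lam b c) := by
  have h : b * (b⁻¹ * a⁻¹ + c) = a⁻¹ + lam b c := by rw [mul_add_eq, mul_inv_cancel_left]
  rw [lam, mul_inv_rev, mul_assoc, h, ← lam]

theorem lam_one (b : T) : lam 1 b = 1 + b := by simp [lam]

theorem one_add_lam (a b : T) : 1 + lam a b = lam a b := by
  rw [← lam_one, ← lam_mul, one_mul]

theorem lam_one_add (a b : T) : lam a (1 + b) = lam a b := by
  rw [← lam_one, ← lam_mul, mul_one]

theorem lam_lam_inv (a b : T) : lam a (lam a⁻¹ b) = 1 + b := by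
  rw [← lam_mul, mul_inv_cancel, lam_one]

theorem add_eq_mul_lam (a b : T) : a + b = a * lam a⁻¹ b := by
  rw [lam, inv_inv, mul_inv_cancel_left]

theorem add_one_add (a b : T) : a + (1 + b) = a + b := by
  rw [add_eq_mul_lam, lam_one_add, ← add_eq_mul_lam]

theorem one_add_one_add (a : T) : 1 + (1 + a) = 1 + a := add_one_add 1 a

theorem one_add_mul {a b : T} (ha : 1 + a = a) (hb : 1 + b = b) : 1 + a * b = a * b := by
  rw [← hb, mul_add_eq, mul_one, ← add_assoc, ha]

theorem one_add_eq_of_add_eq {a b c : T} (h : a + b = a + c) : 1 + b = 1 + c := by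
  rw [add_eq_mul_lam, add_eq_mul_lam a c, mul_right_inj] at h
  rw [← lam_lam_inv a, h, lam_lam_inv]

theorem lam_mul_rho (a b : T) : lam a b * rho b a = a * b := by
  simp [lam, rho, mul_assoc]

theorem rho_rho (a b c : T) :
    rho c (rho b a) = ((b * c)⁻¹ * (a⁻¹ + b * (1 + c)))⁻¹ := by
  have h : b⁻¹ * (a⁻¹ + b * (1 + c)) = (rho b a)⁻¹ + c := by
    rw [mul_add_eq b, mul_one, ← add_assoc, mul_add_eq, ← lam_mul, inv_mul_cancel, lam_one,
      add_one_add, rho, mul_inv_rev, inv_inv]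
  rw [mul_inv_rev b, mul_assoc, h, mul_inv_rev, inv_inv, ← rho]

variable (T) in
/-- The identity characterising the left semi-braces whose associated map is a solution. -/
def Compatible : Prop :=
  ∀ b c : T, 1 + b * (1 + c) = 1 + lam b c * (1 + rho c b)

theorem rho_rho_eq (hT : Compatible T) (a b c : T) :
    rho c (rho b a) = rho (rho c b) (rho (lam b c) a) := by
  rw [rho_rho, rho_rho, lam_mul_rho, ← add_one_add, hT, add_one_add]

theorem lam_lam_eq (a b c : T) : lam (lam a b) (lam (rho b a) c) = lam a (lam b c) := by
  rw [← lam_mul, lam_mul_rho, lam_mul]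

theorem lam_rho_eq (hT : Compatible T) (a b c : T) :
    rho (lam (rho b a) c) (lam a b) = lam (rho (lam b c) a) (rho c b) := by
  have h : lam a (lam b c) * (rho (lam (rho b a) c) (lam a b) * rho c (rho b a)) =
      lam a (lam b c) *
        (lam (rho (lam b c) a) (rho c b) * rho (rho c b) (rho (lam b c) a)) := by
    rw [lam_mul_rho (rho (lam b c) a), ← mul_assoc, ← mul_assoc, lam_mul_rho a, ← lam_lam_eq,
      lam_mul_rho (lam a b), mul_assoc, lam_mul_rho (rho b a), ← mul_assoc, lam_mul_rho,
      mul_assoc, mul_assoc, lam_mul_rho]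
  rw [mul_right_inj, ← rho_rho_eq hT, mul_left_inj] at h
  exact h

section Compatible

variable (hT : Compatible T)
include hT

theorem one_add_mul_one_add_eq (b c : T) :
    1 + b * (1 + c) = lam b c * (1 + rho c b) := by
  rw [hT, one_add_mul (one_add_lam b c) (one_add_one_add _)]

theorem one_add_inv_mul (c : T) : 1 + (1 + c)⁻¹ * c = 1 := by
  have h := one_add_mul_one_add_eq hT 1 c
  rwa [one_mul, lam_one, one_add_one_add, left_eq_mul, rho, inv_one] at h

theorem one_add_one : (1 : T) + 1 = 1 := by
  have h := one_add_inv_mul hT 1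
  calc (1 : T) + 1 = 1 + (1 + (1 + 1)⁻¹ * 1) := by rw [h]
    _ = 1 := by rw [add_one_add, h]

/-- The image of left addition of `1` is closed under inverses. -/
theorem one_add_inv {a : T} (ha : 1 + a = a) : 1 + a⁻¹ = a⁻¹ := by
  obtain ⟨j, hj⟩ : ∃ j, j = a * (1 + a⁻¹) := ⟨_, rfl⟩
  have hi : 1 + j⁻¹ = 1 := by
    rw [hj, mul_inv_rev]
    exact one_add_inv_mul hT a⁻¹
  have hj1 : 1 + j = j := by
    rw [hj]
    exact one_add_mul ha (one_add_one_add _)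
  have hlam : lam j⁻¹ j = 1 := by
    have h : 1 + j⁻¹ * (1 + j) = lam j⁻¹ j := by
      rw [mul_add_eq, mul_one, ← add_assoc, hi, one_add_lam]
    rw [← h, hj1, inv_mul_cancel, one_add_one hT]
  have hjj : j + j = j := by
    rw [lam, inv_inv, inv_mul_eq_one] at hlam
    exact hlam.symm
  have hjadd (y : T) : j + y = 1 + y := by
    rw [← hj1, add_assoc]
    apply one_add_eq_of_add_eq (a := j)
    rw [← add_assoc, hjj]
  have hone : 1 = j⁻¹ := by
    have h := one_add_mul_one_add_eq hT j⁻¹ 1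
    rw [one_add_one hT, mul_one, hi, lam, rho, inv_inv, hjadd, one_add_one hT] at h
    simpa [one_add_one hT] using h
  have h : a * (1 + a⁻¹) = 1 := by rw [← hj, ← inv_inj, ← hone, inv_one]
  exact eq_inv_of_mul_eq_one_right h

/-- Every element in the image of left addition of `1` agrees, as a left summand, with some
`m` such that `1 + u = m * (1 + m⁻¹ * u)`. -/
theorem exists_mul_one_add (u : T) {q : T} (hq : 1 + q = q) :
    ∃ m, (∀ y, m + y = q + y) ∧ m * (1 + m⁻¹ * u) = 1 + u := by
  have hg : 1 + (1 + u)⁻¹ = (1 + u)⁻¹ := one_add_inv hT (one_add_one_add u)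
  obtain ⟨z, hz⟩ : ∃ z, z = lam (1 + u) (1 + u)⁻¹ := ⟨_, rfl⟩
  have huz : 1 + u + z = 1 := by
    have h := mul_add_eq (1 + u) 1 (1 + u)⁻¹
    rw [hg, mul_one, mul_inv_cancel] at h
    rw [hz, ← h]
  have hzu (y : T) : z + (u + y) = 1 + y := by
    have h1 : 1 + (z + (u + y)) = 1 + (1 + y) := by
      apply one_add_eq_of_add_eq (a := 1 + u)
      rw [← add_assoc, huz, add_one_add, add_assoc]
    rw [one_add_one_add] at h1
    rw [← h1, ← add_assoc, ← add_assoc, ← add_assoc, hz, one_add_lam]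
  have hx : 1 + (q + z) = q + z := by rw [← add_assoc, hq]
  refine ⟨q + z + u, fun y => ?_, ?_⟩
  · rw [add_assoc, add_assoc, hzu, add_one_add]
  · have h := one_add_mul_one_add_eq hT (q + z)⁻¹ u
    rw [one_add_mul (one_add_inv hT hx) (one_add_one_add u), lam, rho, inv_inv, mul_assoc,
      mul_right_inj] at h
    exact h.symm

theorem one_add_mul_one_add (u s w : T) (hus : 1 + u * s = u * s) :
    1 + u * (1 + w) = 1 + u * (s + w) * (1 + (s + w)⁻¹ * w) := by
  obtain ⟨m, hm, hmu⟩ := exists_mul_one_add hT u hus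
  obtain ⟨r, hr⟩ : ∃ r, r = u⁻¹ * m := ⟨_, rfl⟩
  have hur : u * r = m := by rw [hr, mul_inv_cancel_left]
  have hsr : s + w = r + w := by
    rw [← mul_right_inj u, mul_add_eq, mul_add_eq, hur, hm]
  rw [hsr]
  obtain ⟨x, hx⟩ : ∃ x, x = w + lam (r + w) ((r + w)⁻¹ * w) := ⟨_, rfl⟩
  have hrx : (r + w) * (1 + (r + w)⁻¹ * w) = r + x := by
    rw [mul_add_eq, mul_one, hx, add_assoc]
  have hkey : lam r r⁻¹ + (1 + w) = 1 + x := by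
    have h := hT r⁻¹ w
    rw [lam, rho, inv_inv, mul_assoc, hrx, mul_add_eq, mul_add_eq, mul_one, inv_mul_cancel,
      one_add_one_add] at h
    have h2 := congrArg (lam r) h
    rwa [lam_one_add, lam_one_add, lam_add, lam_lam_inv, lam_lam_inv] at h2
  have hrm : r⁻¹ = m⁻¹ * u := by rw [hr, mul_inv_rev, inv_inv]
  rw [mul_assoc, hrx, mul_add_eq u r, hur, ← lam_one_add u x, ← hkey, lam_add, ← lam_mul, hur,
    lam_one_add, ← add_assoc m, hrm]
  have h := mul_add_eq m 1 (m⁻¹ * u)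
  rw [hmu, mul_one] at h
  rw [← h, mul_add_eq, mul_one, add_assoc 1 u, one_add_one_add]

end Compatible

end SemiBrace

namespace LeftSemiBrace

variable {S : Type*} (B : LeftSemiBrace S)

theorem isYBE_rmap_iff :
    IsYBE B.rmap ↔
      ∀ b c : S, B.add B.one (B.mul b (B.add B.one c)) =
        B.add B.one (B.mul (B.lam b c) (B.add B.one (B.rho c b))) := by
  let := B.toSemiBrace
  constructor
  · intro h b c
    have h1 : SemiBrace.rho c (SemiBrace.rho b (1 : S)) =
        SemiBrace.rho (SemiBrace.rho c b) (SemiBrace.rho (SemiBrace.lam b c) 1) :=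
      congrArg (fun p => p.2.2) (congrFun h (1, b, c))
    rw [SemiBrace.rho_rho, SemiBrace.rho_rho, SemiBrace.lam_mul_rho, inv_inj, mul_right_inj,
      inv_one] at h1
    exact h1
  · intro h
    have hS : SemiBrace.Compatible S := h
    funext ⟨a, b, c⟩
    exact Prod.ext (SemiBrace.lam_lam_eq a b c)
      (Prod.ext (SemiBrace.lam_rho_eq hS a b c) (SemiBrace.rho_rho_eq hS a b c))

end LeftSemiBrace

/-- Sufficient conditions for the map associated to the asymmetric product of two
left semi-braces having solutions to be a solution. -/
theorem stmt_17 {S T : Type*} (BS : LeftSemiBrace S) (BT : LeftSemiBrace T)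
    (σ : T → S → S)
    (hbij : ∀ u : T, Function.Bijective (σ u))
    (hσadd : ∀ (u : T) (a b : S), σ u (BS.add a b) = BS.add (σ u a) (σ u b))
    (hσmul : ∀ (u : T) (a b : S), σ u (BS.mul a b) = BS.mul (σ u a) (σ u b))
    (hσhom : ∀ (u v : T) (a : S), σ (BT.mul u v) a = σ u (σ v a))
    (δ : S → T → T)
    (hδadd : ∀ (a : S) (u v : T), δ a (BT.add u v) = BT.add (δ a u) (δ a v))
    (𝔟 : S → S → T)
    (hcocycle : ∀ (a b c : S) (u v : T),
      BT.add (BT.add (BT.add (𝔟 (BS.add a b) c) (δ c (𝔟 a b))) (δ c (δ b u))) (δ c v) =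
        BT.add (BT.add (BT.add (𝔟 a (BS.add b c)) (δ (BS.add b c) u)) (𝔟 b c)) (δ c v))
    (hcomp : ∀ (a b c : S) (u v : T),
      BT.add (BT.add (𝔟 (BS.mul a (σ u b)) (BS.lam a (σ u c)))
            (δ (BS.lam a (σ u c)) (BT.mul u v)))
          (BT.mul u (BT.add (𝔟 (σ (BT.inv u) (BS.inv a)) c) (δ c (BT.inv u)))) =
        BT.mul u (BT.add (𝔟 b c) (δ c v)))
    (hS : IsYBE BS.rmap) (hT : IsYBE BT.rmap)
    (hcond1 : ∀ (a : S) (u : T), δ a (δ BS.one u) = δ a u)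
    (hcond2 : ∀ (a : S) (u : T), BT.add (𝔟 BS.one a) u = BT.add BT.one u)
    (hcond3 : ∀ a b : S, 𝔟 a (BS.add BS.one b) = 𝔟 a b)
    (B : LeftSemiBrace (S × T))
    (hadd : ∀ p q : S × T, B.add p q =
      (BS.add p.1 q.1, BT.add (BT.add (𝔟 p.1 q.1) (δ q.1 p.2)) q.2))
    (hmul : ∀ p q : S × T, B.mul p q = (BS.mul p.1 (σ p.2 q.1), BT.mul p.2 q.2)) :
    IsYBE B.rmap := by
  let _ := BS.toSemiBrace
  let _ := BT.toSemiBrace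
  have hS' : SemiBrace.Compatible S := BS.isYBE_rmap_iff.1 hS
  have hT' : SemiBrace.Compatible T := BT.isYBE_rmap_iff.1 hT
  change ∀ (u : T) (a b : S), σ u (a + b) = σ u a + σ u b at hσadd
  change ∀ (u : T) (a b : S), σ u (a * b) = σ u a * σ u b at hσmul
  change ∀ (u v : T) (a : S), σ (u * v) a = σ u (σ v a) at hσhom
  change ∀ (a : S) (u v : T), δ a (u + v) = δ a u + δ a v at hδadd
  change ∀ (a b c : S) (u v : T),
    𝔟 (a * σ u b) (SemiBrace.lam a (σ u c)) + δ (SemiBrace.lam a (σ u c)) (u * v) +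
      u * (𝔟 (σ u⁻¹ a⁻¹) c + δ c u⁻¹) = u * (𝔟 b c + δ c v) at hcomp
  change ∀ (a : S) (u : T), 𝔟 1 a + u = 1 + u at hcond2
  change ∀ p q : S × T, B.add p q = (p.1 + q.1, 𝔟 p.1 q.1 + δ q.1 p.2 + q.2) at hadd
  change ∀ p q : S × T, B.mul p q = (p.1 * σ p.2 q.1, p.2 * q.2) at hmul
  have σ_one_left (a : S) : σ 1 a = a :=
    (hbij 1).1 (by rw [← hσhom, mul_one])
  have σ_one_right (u : T) : σ u (1 : S) = 1 := by
    have h := hσmul u 1 1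
    rwa [mul_one, left_eq_mul] at h
  have σ_inv (u : T) (a : S) : σ u a⁻¹ = (σ u a)⁻¹ := by
    rw [eq_inv_iff_mul_eq_one, ← hσmul, inv_mul_cancel, σ_one_right]
  have σ_σ_inv (u : T) (a : S) : σ u (σ u⁻¹ a) = a := by
    rw [← hσhom, mul_inv_cancel, σ_one_left]
  have hone : B.one = ((1 : S), (1 : T)) := by
    rw [← B.one_mul (1, 1), ← B.mul_one (B.mul _ _), B.one_mul, ← B.mul_inv (1, 1),
      ← B.mul_assoc, hmul (1, 1) (1, 1), σ_one_left, mul_one, mul_one]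
  have hinv (p : S × T) : B.inv p = (σ p.2⁻¹ p.1⁻¹, p.2⁻¹) := by
    have h : B.mul p (σ p.2⁻¹ p.1⁻¹, p.2⁻¹) = B.one := by
      rw [hmul, hone, σ_σ_inv, mul_inv_cancel, mul_inv_cancel]
    rw [← B.mul_one (B.inv p), ← h, ← B.mul_assoc, B.inv_mul, B.one_mul]
  have δ_one_add (c : S) (w : T) : 1 + (δ c 1 + w) = 1 + w := by
    apply SemiBrace.one_add_eq_of_add_eq (a := δ c 1)
    rw [← add_assoc, ← hδadd, SemiBrace.one_add_one hT']
  have hone_add (p : S × T) : B.add B.one p = (1 + p.1, 1 + p.2) := by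
    rw [hadd, hone, add_assoc, hcond2, δ_one_add]
  have hs (b c : S) (v : T) : 1 + v * (𝔟 (σ v⁻¹ b⁻¹) c + δ c v⁻¹) =
      v * (𝔟 (σ v⁻¹ b⁻¹) c + δ c v⁻¹) := by
    have h := hcomp b (σ v⁻¹ b⁻¹) c v v⁻¹
    rw [σ_σ_inv, mul_inv_cancel, mul_inv_cancel, add_assoc, hcond2, δ_one_add] at h
    exact h
  rw [B.isYBE_rmap_iff]
  rintro ⟨b, v⟩ ⟨c, w⟩
  obtain ⟨d, hd⟩ : ∃ d, d = σ v⁻¹ b⁻¹ + c := ⟨_, rfl⟩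
  obtain ⟨e, he⟩ : ∃ e, e = 𝔟 (σ v⁻¹ b⁻¹) c + δ c v⁻¹ + w := ⟨_, rfl⟩
  have hde : B.add (σ v⁻¹ b⁻¹, v⁻¹) (c, w) = (d, e) := by rw [hadd, hd, he]
  have hσd : σ v d = b⁻¹ + σ v c := by rw [hd, hσadd, σ_σ_inv]
  simp only [LeftSemiBrace.lam, LeftSemiBrace.rho, hone_add, hmul, hinv, hde]
  refine Prod.ext ?_ ?_
  · have h := hS' b (σ v c)
    rw [SemiBrace.lam, SemiBrace.rho, ← hσd] at h
    simpa only [hσadd, hσhom, σ_one_right, hσmul, σ_σ_inv, σ_inv] using h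
  · subst he
    exact SemiBrace.one_add_mul_one_add hT' v _ w (hs b c v)
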